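/- Let G be a position with c(G) ≥ 2, and let C be a component of G such that tb(G−C) = tb(G) and such that c(G−C) ≥ 2 if C is a chain and c(G−C) ≥ 4 if C is a loop. Then opening C is optimal, i.e. v(G;C) = v(G), and moreover v(G) = c(G). -/

import Mathlib

namespace DotsAndBoxes

/-- A component of a Dots & Boxes endgame position: an `n`-chain or an `n`-loop. -/
inductive Component : Type where
  | chain (n : ℕ)
  | loop (n : ℕ)
deriving DecidableEq

namespace Component

/-- The number of boxes in a component. -/
def size : Component → ℕ
  | chain n => n
  | loop n => n

def isChain : Component → Bool
  | chain _ => true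
  | loop _ => false

def isLoop : Component → Bool
  | chain _ => false
  | loop _ => true

/-- A chain must have length at least 3; a loop must have even length at least 4. -/
def Valid : Component → Prop
  | chain n => 3 ≤ n
  | loop n => 4 ≤ n ∧ Even n

end Component

/-- A position is a finite multiset of components. -/
abbrev Position := Multiset Component

def Position.Valid (G : Position) : Prop := ∀ C ∈ G, C.Valid

/-- The number of unclaimed boxes in a position. -/
def size (G : Position) : ℕ := (G.map Component.size).sum

/-- The number of chains of a position. -/
def numChains (G : Position) : ℕ := Multiset.card (G.filter fun C => C.isChain = true)

/-- The number of loops of a position. -/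
def numLoops (G : Position) : ℕ := Multiset.card (G.filter fun C => C.isLoop = true)

/-- θ(G), the number of 3-chains. -/
def theta (G : Position) : ℕ := G.count (Component.chain 3)

/-- f(G), the number of 4-loops. -/
def numF (G : Position) : ℕ := G.count (Component.loop 4)

/-- s(G), the number of 6-loops. -/
def numS (G : Position) : ℕ := G.count (Component.loop 6)

open Classical in
/-- The terminal bonus tb(G). -/
noncomputable def tb (G : Position) : ℤ :=
  if G = 0 then 0
  else if ∀ C ∈ G, C.isLoop = true then 8
  else if (∃ C ∈ G, C.isLoop = true) ∧ Component.chain 3 ∈ G ∧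
      (∀ C ∈ G, C.isChain = true → C = Component.chain 3) then 6
  else 4

/-- The controlled value c(G). -/
noncomputable def cval (G : Position) : ℤ :=
  (size G : ℤ) - 4 * (numChains G : ℤ) - 8 * (numLoops G : ℤ) + tb G

/-- The score v(G;C) of opening component `C`, given that the remainder of the
position has value `w`. -/
def openVal (C : Component) (w : ℤ) : ℤ :=
  match C with
  | Component.chain n => ((n : ℤ) - 2) + |w - 2|
  | Component.loop n => ((n : ℤ) - 4) + |w - 4|

/-- Auxiliary recursion (on the number of components) for the value `v`. -/
noncomputable def valueAux : ℕ → Position → ℤ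
  | 0, _ => 0
  | n + 1, G =>
    if G = 0 then 0
    else sInf { x : ℤ | ∃ C ∈ G, x = openVal C (valueAux n (G.erase C)) }

/-- The value v(G): v(∅) = 0, and v(G) = min over components C of G of v(G;C). -/
noncomputable def value (G : Position) : ℤ := valueAux (Multiset.card G) G

/-- v(G;C), the value of G given that the opener has just opened C. -/
noncomputable def valueOpen (G : Position) (C : Component) : ℤ :=
  openVal C (value (G.erase C))

/-- Opening a component C of G is optimal if C ∈ G and v(G;C) = v(G). -/
def Optimal (G : Position) (C : Component) : Prop :=
  C ∈ G ∧ valueOpen G C = value G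


/-- The weight of a component in the controlled value. -/
def wt : Component → ℤ
  | Component.chain n => (n : ℤ) - 4
  | Component.loop n => (n : ℤ) - 8

lemma cval_zero : cval 0 = 0 := by
  simp [cval, size, numChains, numLoops, tb]

lemma cval_cons (C : Component) (H : Position) :
    cval (C ::ₘ H) = cval H + wt C + tb (C ::ₘ H) - tb H := by
  have c1 : ∀ n, (Component.chain n).isChain = true := fun _ => rfl
  have c2 : ∀ n, (Component.chain n).isLoop = false := fun _ => rfl
  have c3 : ∀ n, (Component.loop n).isChain = false := fun _ => rfl
  have c4 : ∀ n, (Component.loop n).isLoop = true := fun _ => rfl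
  cases C <;> simp [cval, size, numChains, numLoops, wt, c1, c2, c3, c4,
    Component.size] <;> ring

lemma value_zero : value 0 = 0 := by
  simp [value, valueAux]

lemma value_set (G : Position) (h : G ≠ 0) :
    value G = sInf { x : ℤ | ∃ C ∈ G, x = openVal C (value (G.erase C)) } := by
  obtain ⟨n, hn⟩ : ∃ n, Multiset.card G = n + 1 :=
    Nat.exists_eq_succ_of_ne_zero (by simpa using h)
  have : ∀ C ∈ G, Multiset.card (G.erase C) = n := by
    intro C hC
    rw [Multiset.card_erase_of_mem hC, hn]; rfl
  rw [value, hn, valueAux, if_neg h]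
  congr 1
  ext x
  constructor
  · rintro ⟨C, hC, hx⟩
    exact ⟨C, hC, by rw [hx, value, this C hC]⟩
  · rintro ⟨C, hC, hx⟩
    exact ⟨C, hC, by rw [hx, value, this C hC]⟩

lemma set_bdd (G : Position) :
    BddBelow { x : ℤ | ∃ C ∈ G, x = openVal C (value (G.erase C)) } := by
  classical
  apply Set.Finite.bddBelow
  apply (G.toFinset.image (fun C => openVal C (value (G.erase C)))).finite_toSet.subset
  rintro x ⟨C, hC, hx⟩
  simp only [Finset.coe_image, Set.mem_image, Finset.mem_coe, Multiset.mem_toFinset]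
  exact ⟨C, hC, hx.symm⟩

lemma value_le (C : Component) (H : Position) : value (C ::ₘ H) ≤ openVal C (value H) := by
  rw [value_set _ (Multiset.cons_ne_zero)]
  exact csInf_le (set_bdd _) ⟨C, by simp, by simp⟩

lemma value_ex (G : Position) (h : G ≠ 0) :
    ∃ C H, G = C ::ₘ H ∧ value G = openVal C (value H) := by
  obtain ⟨D, hD⟩ := Multiset.exists_mem_of_ne_zero h
  obtain ⟨C, hC, hx⟩ := Int.csInf_mem
    (s := { x : ℤ | ∃ C ∈ G, x = openVal C (value (G.erase C)) }) ⟨_, D, hD, rfl⟩ (set_bdd G)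
  exact ⟨C, G.erase C, (Multiset.cons_erase hC).symm, by rw [value_set G h, hx]⟩

lemma value_single (C : Component) (h : C.Valid) : value {C} = C.size := by
  obtain ⟨D, H, h1, h2⟩ := value_ex {C} (by simp)
  have h3 := (Multiset.singleton_eq_cons_iff _).1 h1
  obtain ⟨rfl, rfl⟩ := h3
  rw [h2, value_zero]
  cases C <;> simp [openVal, Component.size]

lemma tb_zero : tb 0 = 0 := by simp [tb]

lemma tb_eight {G : Position} (h0 : G ≠ 0) (h : ∀ C ∈ G, C.isLoop = true) : tb G = 8 := by
  rw [tb, if_neg h0, if_pos h]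

lemma tb_big {G : Position} {n : ℕ} (h : Component.chain n ∈ G) (h3 : n ≠ 3) : tb G = 4 := by
  rw [tb, if_neg, if_neg, if_neg]
  · rintro ⟨-, -, h'⟩
    have := h' _ h rfl
    simp at this
    exact h3 this
  · intro h'
    have := h' _ h
    simp [Component.isLoop] at this
  · rintro rfl
    simp at h

lemma tb_six {G : Position} {n : ℕ} (h : Component.loop n ∈ G) (h3 : Component.chain 3 ∈ G)
    (h' : ∀ m, Component.chain m ∈ G → m = 3) : tb G = 6 := by
  rw [tb, if_neg, if_neg, if_pos]
  · refine ⟨⟨_, h, rfl⟩, h3, ?_⟩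
    rintro (m | m) hm hc
    · rw [h' m hm]
    · simp [Component.isChain] at hc
  · intro h'
    have := h' _ h3
    simp [Component.isLoop] at this
  · rintro rfl
    simp at h

lemma tb_threes {G : Position} (h0 : G ≠ 0) (h : ∀ C ∈ G, C = Component.chain 3) : tb G = 4 := by
  obtain ⟨D, hD⟩ := Multiset.exists_mem_of_ne_zero h0
  have h3 := hD
  rw [h D hD] at h3
  rw [tb, if_neg h0, if_neg, if_neg]
  · rintro ⟨⟨C, hC, hl⟩, -⟩
    rw [h C hC] at hl
    simp [Component.isLoop] at hl
  · intro h'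
    have := h' _ h3
    simp [Component.isLoop] at this

lemma cases_pos (G : Position) : G = 0 ∨ (G ≠ 0 ∧ ∀ C ∈ G, C.isLoop = true) ∨
    (∃ n, n ≠ 3 ∧ Component.chain n ∈ G) ∨ (G ≠ 0 ∧ ∀ C ∈ G, C = Component.chain 3) ∨
    ((∃ n, Component.loop n ∈ G) ∧ Component.chain 3 ∈ G ∧
      ∀ m, Component.chain m ∈ G → m = 3) := by
  by_cases h0 : G = 0
  · exact Or.inl h0
  by_cases h1 : ∃ n, n ≠ 3 ∧ Component.chain n ∈ G
  · exact Or.inr (Or.inr (Or.inl h1))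
  have h1' : ∀ m, Component.chain m ∈ G → m = 3 := by
    intro m hm
    by_contra hne
    exact h1 ⟨m, hne, hm⟩
  by_cases h2 : Component.chain 3 ∈ G
  · by_cases h3 : ∃ n, Component.loop n ∈ G
    · exact Or.inr (Or.inr (Or.inr (Or.inr ⟨h3, h2, h1'⟩)))
    · refine Or.inr (Or.inr (Or.inr (Or.inl ⟨h0, ?_⟩)))
      rintro (m | m) hm
      · rw [h1' m hm]
      · exact absurd ⟨m, hm⟩ h3
  · refine Or.inr (Or.inl ⟨h0, ?_⟩)
    rintro (m | m) hm
    · have := h1' m hm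
      subst this
      exact absurd hm h2
    · rfl

lemma tb_vals {G : Position} (h0 : G ≠ 0) : 4 ≤ tb G ∧ tb G ≤ 8 := by
  rw [tb, if_neg h0]
  split_ifs <;> norm_num

lemma tb_cons_le {C : Component} {H : Position} (h0 : H ≠ 0)
    (h : C.isLoop = true → ¬ ∀ D ∈ H, D = Component.chain 3) : tb (C ::ₘ H) ≤ tb H := by
  rcases cases_pos H with h1 | ⟨-, h1⟩ | ⟨n, hn, h1⟩ | ⟨-, h1⟩ | ⟨⟨n, hn⟩, h3, h1⟩
  · exact absurd h1 h0
  · rw [tb_eight h0 h1]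
    exact (tb_vals Multiset.cons_ne_zero).2
  · rw [tb_big h1 hn, tb_big (Multiset.mem_cons_of_mem h1) hn]
  · rw [tb_threes h0 h1]
    rcases C with m | m
    · by_cases hm : m = 3
      · subst hm
        rw [tb_threes Multiset.cons_ne_zero]
        intro D hD
        rcases Multiset.mem_cons.1 hD with h | h
        · exact h
        · exact h1 D h
      · rw [tb_big (Multiset.mem_cons_self _ _) hm]
    · exact absurd h1 (h rfl)
  · rw [tb_six hn h3 h1]
    rcases C with m | m
    · by_cases hm : m = 3
      · subst hm
        rw [tb_six (Multiset.mem_cons_of_mem hn) (Multiset.mem_cons_of_mem h3)]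
        intro k hk
        rcases Multiset.mem_cons.1 hk with h | h
        · simpa using h
        · exact h1 k h
      · rw [tb_big (Multiset.mem_cons_self _ _) hm]
        norm_num
    · rw [tb_six (Multiset.mem_cons_of_mem hn) (Multiset.mem_cons_of_mem h3)]
      intro k hk
      rcases Multiset.mem_cons.1 hk with h | h
      · simp at h
      · exact h1 k h

lemma valid_cons {C : Component} {H : Position} :
    Position.Valid (C ::ₘ H) ↔ C.Valid ∧ Position.Valid H := by
  simp [Position.Valid]

lemma cval_single (C : Component) : cval {C} = C.size := by
  have h := cval_cons C 0
  rw [cval_zero, tb_zero] at h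
  rw [← Multiset.cons_zero, h]
  rcases C with m | m
  · by_cases hm : m = 3
    · subst hm
      rw [tb_threes Multiset.cons_ne_zero (by simp)]
      simp [wt, Component.size]
    · rw [tb_big (Multiset.mem_cons_self _ _) hm]
      simp [wt, Component.size]
  · rw [tb_eight Multiset.cons_ne_zero (by simp [Component.isLoop])]
    simp [wt, Component.size]

lemma cval_threes (H : Position) (h0 : H ≠ 0) (h : ∀ D ∈ H, D = Component.chain 3) :
    cval H = 4 - Multiset.card H := by
  rw [← tb_threes h0 h]
  clear h0
  induction H using Multiset.induction_on with
  | empty => simp [cval_zero, tb_zero]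
  | cons C H ih =>
    have h1 := h C (by simp)
    have h2 := ih (fun D hD => h D (by simp [hD]))
    have := cval_cons C H
    subst h1
    simp only [wt] at this
    rw [this, h2, Multiset.card_cons]
    push_cast
    ring

lemma openVal_ge (C : Component) (w : ℤ) : w + wt C ≤ openVal C w := by
  rcases C with m | m <;> simp only [openVal, wt]
  · have := le_abs_self (w - 2); linarith
  · have := le_abs_self (w - 4); linarith

/-- The controlled value is always a lower bound. -/
lemma cval_le_value (G : Position) : G.Valid → cval G ≤ value G := by
  induction hn : Multiset.card G using Nat.strong_induction_on generalizing G with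
  | _ n ih =>
  intro hG
  by_cases h0 : G = 0
  · subst h0
    rw [cval_zero, value_zero]
  obtain ⟨C, H, rfl, hv⟩ := value_ex G h0
  obtain ⟨hCv, hHv⟩ := valid_cons.1 hG
  have hH := ih (Multiset.card H) (by rw [← hn]; simp) H rfl hHv
  by_cases hH0 : H = 0
  · subst hH0
    rw [Multiset.cons_zero, value_single C hCv, cval_single]
  have hc := cval_cons C H
  have ho := openVal_ge C (value H)
  by_cases hs : C.isLoop = true ∧ ∀ D ∈ H, D = Component.chain 3
  · obtain ⟨hl, h3⟩ := hs
    rcases C with m | m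
    · simp [Component.isLoop] at hl
    obtain ⟨D, hD⟩ := Multiset.exists_mem_of_ne_zero hH0
    rw [h3 D hD] at hD
    have t6 : tb (Component.loop m ::ₘ H) = 6 := by
      refine tb_six (Multiset.mem_cons_self _ _) (Multiset.mem_cons_of_mem hD) ?_
      intro k hk
      rcases Multiset.mem_cons.1 hk with h | h
      · simp at h
      · simpa using h3 _ h
    rw [t6, tb_threes hH0 h3, cval_threes H hH0 h3] at hc
    rw [hv, hc]
    simp only [wt, openVal]
    have hpos : Multiset.card H ≠ 0 := by simpa using hH0
    by_cases h1 : Multiset.card H = 1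
    · obtain ⟨E, rfl⟩ := Multiset.card_eq_one.1 h1
      rw [value_single E (hHv E (by simp)), h3 E (by simp)]
      norm_num [Component.size]
      linarith
    · have := abs_nonneg (value H - 4)
      omega
  · have := tb_cons_le hH0 (fun hl h3 => hs ⟨hl, h3⟩)
    linarith

/-- Opening step. -/
lemma open_eq {C : Component} {H : Position} (htb : tb H = tb (C ::ₘ H))
    (hv : value H = cval H) (h2 : C.isChain = true → 2 ≤ cval H)
    (h4 : C.isLoop = true → 4 ≤ cval H) : openVal C (value H) = cval (C ::ₘ H) := by
  rw [cval_cons, ← htb, hv]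
  rcases C with m | m <;> simp only [openVal, wt]
  · rw [abs_of_nonneg (by linarith [h2 rfl])]; ring
  · rw [abs_of_nonneg (by linarith [h4 rfl])]; ring

lemma cval_big (H : Position) (h : ∀ D ∈ H, 0 ≤ wt D) : tb H ≤ cval H := by
  induction H using Multiset.induction_on with
  | empty => rw [cval_zero, tb_zero]
  | cons C H ih =>
    have h1 := h C (by simp)
    have h2 := ih (fun D hD => h D (by simp [hD]))
    have := cval_cons C H
    linarith

lemma loop_dich {G : Position} (hG : G.Valid) :
    (∃ n, Component.loop n ∈ G ∧ n ≤ 6) ∨ ∀ n, Component.loop n ∈ G → 8 ≤ n := by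
  by_cases h : ∃ n, Component.loop n ∈ G ∧ n ≤ 6
  · exact Or.inl h
  · refine Or.inr fun n hn => ?_
    have h1 : ¬ n ≤ 6 := fun h' => h ⟨n, hn, h'⟩
    obtain ⟨-, k, hk⟩ := hG _ hn
    omega

/-- If the controlled value is at least 2, it is the value. -/
lemma value_eq_cval (G : Position) : G.Valid → 2 ≤ cval G → value G = cval G := by
  induction hn : Multiset.card G using Nat.strong_induction_on generalizing G with
  | _ n ih =>
  intro hG hc
  refine le_antisymm ?_ (cval_le_value G hG)
  -- reduction to finding a good component
  have key : ∀ C H, G = C ::ₘ H → tb H = tb G → 2 ≤ cval H →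
      (C.isLoop = true → 4 ≤ cval H) → value G ≤ cval G := by
    rintro C H rfl htb h2 h4
    have hv := ih (Multiset.card H) (by rw [← hn]; simp) H rfl (valid_cons.1 hG).2 h2
    exact (value_le C H).trans (open_eq htb hv (fun _ => h2) h4).le
  -- removing a short loop
  have keyl : ∀ k H, G = Component.loop k ::ₘ H → k ≤ 6 → tb H = tb G → value G ≤ cval G := by
    intro k H hGH hk htb
    have h := cval_cons (Component.loop k) H
    rw [← hGH, htb] at h
    simp only [wt] at h
    have : (k : ℤ) ≤ 6 := by exact_mod_cast hk
    exact key _ H hGH htb (by linarith) (fun _ => by linarith)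
  -- removing a 3-chain
  have key3 : ∀ H, G = Component.chain 3 ::ₘ H → tb H = tb G → value G ≤ cval G := by
    intro H hGH htb
    have h := cval_cons (Component.chain 3) H
    rw [← hGH, htb] at h
    simp only [wt] at h
    push_cast at h
    exact key _ H hGH htb (by linarith) (by simp [Component.isLoop])
  have single : ∀ C, G = {C} → value G ≤ cval G := by
    rintro C rfl
    rw [value_single C (hG C (by simp)), cval_single]
  rcases cases_pos G with h1 | ⟨h0, h1⟩ | ⟨k, hk, h1⟩ | ⟨h0, h1⟩ | ⟨⟨k, hk⟩, h3, h1⟩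
  · subst h1
    rw [cval_zero] at hc
    omega
  · -- all loops
    have ht := tb_eight h0 h1
    have hsub : ∀ C H, G = C ::ₘ H → H ≠ 0 → tb H = 8 := by
      rintro C H rfl hH
      exact tb_eight hH (fun D hD => h1 D (by simp [hD]))
    rcases loop_dich hG with ⟨m, hm, hm6⟩ | hL
    · obtain ⟨H, hH⟩ := Multiset.exists_cons_of_mem hm
      by_cases hH0 : H = 0
      · subst hH0
        exact single _ hH
      · exact keyl m H hH hm6 (by rw [ht, hsub _ _ hH hH0])
    · obtain ⟨D, hD⟩ := Multiset.exists_mem_of_ne_zero h0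
      obtain ⟨H, hH⟩ := Multiset.exists_cons_of_mem hD
      by_cases hH0 : H = 0
      · subst hH0
        exact single _ hH
      · have h8 := hsub _ _ hH hH0
        have hb := cval_big H (by
          rintro (j | j) hj
          · have := h1 (Component.chain j) (by rw [hH]; simp [hj])
            simp [Component.isLoop] at this
          · have := hL j (by rw [hH]; simp [hj])
            simp only [wt]
            omega)
        exact key D H hH (by rw [ht, h8]) (by linarith) (fun _ => by linarith)
  · -- a long chain
    have ht := tb_big h1 hk
    obtain ⟨K, hK⟩ := Multiset.exists_cons_of_mem h1
    by_cases h3 : Component.chain 3 ∈ K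
    · obtain ⟨H, rfl⟩ := Multiset.exists_cons_of_mem h3
      rw [Multiset.cons_swap] at hK
      exact key3 _ hK (by rw [ht, tb_big (Multiset.mem_cons_self _ _) hk])
    have hK0 : ∀ m, Component.chain m ∈ G → 4 ≤ m := by
      intro m hm
      have hv : 3 ≤ m := hG _ hm
      have : m ≠ 3 := by
        rintro rfl
        rw [hK] at hm
        rcases Multiset.mem_cons.1 hm with h | h
        · simp at h
          exact hk h.symm
        · exact h3 h
      omega
    rcases loop_dich hG with ⟨m, hm, hm6⟩ | hL
    · rw [hK] at hm
      rcases Multiset.mem_cons.1 hm with h | h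
      · simp at h
      obtain ⟨H, rfl⟩ := Multiset.exists_cons_of_mem h
      rw [Multiset.cons_swap] at hK
      exact keyl m _ hK hm6 (by rw [ht, tb_big (Multiset.mem_cons_self _ _) hk])
    · by_cases hKz : K = 0
      · subst hKz
        exact single _ hK
      obtain ⟨D, hD⟩ := Multiset.exists_mem_of_ne_zero hKz
      obtain ⟨H, rfl⟩ := Multiset.exists_cons_of_mem hD
      rw [Multiset.cons_swap] at hK
      have h4 := tb_big (Multiset.mem_cons_self (Component.chain k) H) hk
      have hb := cval_big (Component.chain k ::ₘ H) (by
          rintro (j | j) hj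
          · have := hK0 j (by rw [hK]; exact Multiset.mem_cons_of_mem hj)
            simp only [wt]
            omega
          · have := hL j (by rw [hK]; exact Multiset.mem_cons_of_mem hj)
            simp only [wt]
            omega)
      exact key D _ hK (by rw [ht, h4]) (by linarith) (fun _ => by linarith)
  · -- only 3-chains
    obtain ⟨D, hD⟩ := Multiset.exists_mem_of_ne_zero h0
    obtain ⟨H, hH⟩ := Multiset.exists_cons_of_mem hD
    by_cases hH0 : H = 0
    · subst hH0
      exact single _ hH
    have hD3 := h1 D hD
    subst hD3
    refine key3 H hH ?_
    rw [tb_threes h0 h1, tb_threes hH0]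
    intro E hE
    exact h1 E (by rw [hH]; simp [hE])
  · -- loops and 3-chains
    have ht := tb_six hk h3 h1
    obtain ⟨K, hK⟩ := Multiset.exists_cons_of_mem h3
    have hkK : Component.loop k ∈ K := by
      rw [hK] at hk
      simpa using hk
    by_cases h3K : Component.chain 3 ∈ K
    · refine key3 K hK ?_
      rw [ht, tb_six hkK h3K]
      intro m hm
      exact h1 m (by rw [hK]; simp [hm])
    have hKl : ∀ m, Component.chain m ∉ K := by
      intro m hm
      have := h1 m (by rw [hK]; simp [hm])
      subst this
      exact h3K hm
    -- choose a loop whose removal is good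
    have hsel : ∃ j H, K = Component.loop j ::ₘ H ∧
        (j ≤ 6 ∨ ∀ n, Component.loop n ∈ G → 8 ≤ n) := by
      rcases loop_dich hG with ⟨m, hm, hm6⟩ | hL
      · have hmK : Component.loop m ∈ K := by
          rw [hK] at hm
          simpa using hm
        obtain ⟨H, hH⟩ := Multiset.exists_cons_of_mem hmK
        exact ⟨m, H, hH, Or.inl hm6⟩
      · obtain ⟨H, hH⟩ := Multiset.exists_cons_of_mem hkK
        exact ⟨k, H, hH, Or.inr hL⟩
    obtain ⟨j, H, rfl, hj⟩ := hsel
    rw [Multiset.cons_swap] at hK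
    by_cases hH0 : H = 0
    · subst hH0
      have hcv := cval_cons (Component.loop j) (Component.chain 3 ::ₘ 0)
      have hle := value_le (Component.loop j) (Component.chain 3 ::ₘ 0)
      rw [← hK] at hcv hle
      rw [Multiset.cons_zero, value_single (Component.chain 3) (le_refl 3)] at hle
      rw [ht, tb_threes (Multiset.cons_ne_zero) (by simp), Multiset.cons_zero,
        cval_single] at hcv
      simp only [openVal, wt, Component.size] at hcv hle
      norm_num at hcv hle
      linarith
    obtain ⟨E, hE⟩ := Multiset.exists_mem_of_ne_zero hH0
    have hEl : ∃ e, E = Component.loop e := by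
      rcases E with e | e
      · exact absurd (Multiset.mem_cons_of_mem hE) (hKl e)
      · exact ⟨e, rfl⟩
    obtain ⟨e, rfl⟩ := hEl
    have ht6 : tb (Component.chain 3 ::ₘ H) = 6 := by
      refine tb_six (Multiset.mem_cons_of_mem hE) (Multiset.mem_cons_self _ _) ?_
      intro m hm
      exact h1 m (by rw [hK]; exact Multiset.mem_cons_of_mem hm)
    rcases hj with hj | hL
    · exact keyl j _ hK hj (by rw [ht, ht6])
    · have hb := cval_big H (by
          rintro (i | i) hi
          · exact absurd (Multiset.mem_cons_of_mem hi) (hKl i)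
          · have := hL i (by
              rw [hK]; exact Multiset.mem_cons_of_mem (Multiset.mem_cons_of_mem hi))
            simp only [wt]
            omega)
      have hcv := cval_cons (Component.chain 3) H
      rw [ht6] at hcv
      simp only [wt] at hcv
      push_cast at hcv
      exact key _ _ hK (by rw [ht, ht6]) (by linarith) (fun _ => by linarith)

/-- If c(G) ≥ 2 and C is a component with tb(G−C) = tb(G) and c(G−C) ≥ 2 (if C is a
chain) or c(G−C) ≥ 4 (if C is a loop), then opening C is optimal and v(G) = c(G). -/
theorem optimal_component (G : Position) (hG : G.Valid) (hc : 2 ≤ cval G)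
    (C : Component) (hC : C ∈ G) (htb : tb (G.erase C) = tb G)
    (hchain : C.isChain = true → 2 ≤ cval (G.erase C))
    (hloop : C.isLoop = true → 4 ≤ cval (G.erase C)) :
    Optimal G C ∧ value G = cval G := by
  have hv := value_eq_cval G hG hc
  refine ⟨⟨hC, ?_⟩, hv⟩
  have h2 : 2 ≤ cval (G.erase C) := by
    rcases C with m | m
    · exact hchain rfl
    · linarith [hloop rfl]
  have hv' := value_eq_cval (G.erase C) (fun D hD => hG D (Multiset.mem_of_mem_erase hD)) h2
  have hcons := Multiset.cons_erase hC
  have := open_eq (C := C) (H := G.erase C) (by rw [hcons, htb]) hv' hchain hloop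
  rw [hcons] at this
  rw [valueOpen, this, hv]

end DotsAndBoxes
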